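/- arXiv:1407.7303 — 6 statements merged into one kernel-verified Lean document; each statement's English description precedes it below -/
import Mathlib

section
/- Let n ≥ 1 and let v : ℝⁿ → ℝⁿ and p : ℝⁿ → ℝ be measurable functions such that |p| + |v|² is integrable on ℝⁿ (i.e. p ∈ L¹ and each product v_j v_k ∈ L¹). Assume that for every ξ ∈ ℝⁿ with ξ ≠ 0 the Fourier transforms satisfy p̂(ξ) = −Σ_{j,k=1}^n (ξ_j ξ_k / |ξ|²) · (v_j v_k)^(ξ). Then for all j, k ∈ {1,…,n} one has ∫_{ℝⁿ} v_j v_k dx = −δ_{jk} ∫_{ℝⁿ} p dx, where δ_{jk} is the Kronecker delta. -/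
open MeasureTheory Real
open scoped FourierTransform

theorem continuous_fourier_of_integrable {n : ℕ} {f : EuclideanSpace ℝ (Fin n) → ℂ}
    (hf : Integrable f) : Continuous (𝓕 f) :=
  VectorFourier.fourierIntegral_continuous Real.continuous_fourierChar
    (L := innerₗ (EuclideanSpace ℝ (Fin n))) continuous_inner hf

theorem fourier_ofReal_zero {n : ℕ} (f : EuclideanSpace ℝ (Fin n) → ℝ) :
    𝓕 (fun x => (f x : ℂ)) 0 = ((∫ x, f x : ℝ) : ℂ) := by
  simp [Real.fourier_eq, integral_complex_ofReal]

/-- Letting `ξ → 0` along the ray through `η` turns a Fourier multiplier relation with symbol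
`ξ_j ξ_k / |ξ|²` into a quadratic identity for the integrals. -/
theorem integral_mul_norm_sq_of_fourier_eq {n : ℕ}
    (p : EuclideanSpace ℝ (Fin n) → ℝ) (w : Fin n → Fin n → EuclideanSpace ℝ (Fin n) → ℝ)
    (hp : Integrable p) (hw : ∀ j k, Integrable (w j k))
    (hFourier : ∀ ξ : EuclideanSpace ℝ (Fin n), ξ ≠ 0 →
      𝓕 (fun x => (p x : ℂ)) ξ =
        -∑ j : Fin n, ∑ k : Fin n,
          ((ξ j : ℂ) * (ξ k : ℂ) / (‖ξ‖ ^ 2 : ℝ)) * 𝓕 (fun x => ((w j k x : ℝ) : ℂ)) ξ)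
    (η : EuclideanSpace ℝ (Fin n)) :
    ‖η‖ ^ 2 * ∫ x, p x = -∑ j : Fin n, ∑ k : Fin n, η j * η k * ∫ x, w j k x := by
  rcases eq_or_ne η 0 with rfl | hη
  · simp
  have hnorm : ((‖η‖ : ℝ) : ℂ) ≠ 0 := by simpa using hη
  have hp' := continuous_fourier_of_integrable (hp.ofReal (𝕜 := ℂ))
  have hw' := fun j k => continuous_fourier_of_integrable ((hw j k).ofReal (𝕜 := ℂ))
  have hext : (fun t : ℝ => 𝓕 (fun x => (p x : ℂ)) (t • η)) = fun t : ℝ =>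
      -∑ j : Fin n, ∑ k : Fin n,
        ((η j : ℂ) * (η k : ℂ) / (‖η‖ ^ 2 : ℝ)) * 𝓕 (fun x => ((w j k x : ℝ) : ℂ)) (t • η) := by
    refine Continuous.ext_on (dense_compl_singleton (0 : ℝ)) ?_ ?_ ?_
    · exact hp'.comp (by fun_prop)
    · refine (continuous_finsetSum _ fun j _ => continuous_finsetSum _ fun k _ => ?_).neg
      exact continuous_const.mul ((hw' j k).comp (by fun_prop))
    · intro t ht
      have ht0 : (t : ℂ) ≠ 0 := by simpa using ht
      have hsq : ((‖t • η‖ ^ 2 : ℝ) : ℂ) = (t : ℂ) ^ 2 * (‖η‖ : ℂ) ^ 2 := by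
        rw [norm_smul, mul_pow, Real.norm_eq_abs, sq_abs]
        push_cast
        rfl
      simp only
      rw [hFourier _ (smul_ne_zero ht hη), hsq]
      congr 1
      refine Finset.sum_congr rfl fun j _ => Finset.sum_congr rfl fun k _ => ?_
      congr 1
      simp only [PiLp.smul_apply, smul_eq_mul]
      push_cast
      field_simp
  have h0 := congrFun hext 0
  simp only [zero_smul, fourier_ofReal_zero] at h0
  have h1 : ∫ x, p x = -∑ j : Fin n, ∑ k : Fin n, η j * η k / ‖η‖ ^ 2 * ∫ x, w j k x := by
    exact_mod_cast h0
  have hnorm' : ‖η‖ ≠ 0 := norm_ne_zero_iff.mpr hη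
  rw [h1, mul_neg, Finset.mul_sum]
  congr 1
  refine Finset.sum_congr rfl fun j _ => ?_
  rw [Finset.mul_sum]
  refine Finset.sum_congr rfl fun k _ => ?_
  field_simp

/-- Polarization: a symmetric matrix whose quadratic form is `-P |η|²` equals `-P` times the
identity. -/
theorem eq_neg_ite_mul_of_quadratic_form {n : ℕ} (P : ℝ) (A : Fin n → Fin n → ℝ)
    (hA : ∀ j k, A j k = A k j)
    (h : ∀ η : EuclideanSpace ℝ (Fin n),
      ‖η‖ ^ 2 * P = -∑ j : Fin n, ∑ k : Fin n, η j * η k * A j k) (j k : Fin n) :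
    A j k = -(if j = k then (1 : ℝ) else 0) * P := by
  have hdiag : ∀ i, P = -A i i := fun i => by
    have := h (EuclideanSpace.single i 1)
    simpa [Pi.single_apply] using this
  split_ifs with hjk
  · subst hjk
    linarith [hdiag j]
  · have hsum := h (EuclideanSpace.single j 1 + EuclideanSpace.single k 1)
    have hnorm : ‖EuclideanSpace.single j (1 : ℝ) + EuclideanSpace.single k 1‖ ^ 2 = 2 := by
      rw [norm_add_sq_real]
      simp [EuclideanSpace.inner_single_left, hjk]
      norm_num
    rw [hnorm] at hsum
    simp [add_mul, mul_add, Finset.sum_add_distrib] at hsum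
    linarith [hdiag j, hdiag k, hA j k]

/-- **Orthogonality relation for the velocity of finite-energy Euler flows.**
If `p ∈ L¹` and each product `v_j v_k ∈ L¹`, and on the Fourier side
`p̂(ξ) = −Σ_{j,k} (ξ_j ξ_k / |ξ|²) (v_j v_k)^(ξ)` for all `ξ ≠ 0`, then
`∫ v_j v_k dx = −δ_{jk} ∫ p dx`. -/
theorem orthogonality_of_pressure_velocity
    (n : ℕ) (hn : 1 ≤ n)
    (v : EuclideanSpace ℝ (Fin n) → EuclideanSpace ℝ (Fin n))
    (p : EuclideanSpace ℝ (Fin n) → ℝ)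
    (hv : Measurable v) (hp : Measurable p)
    (hpInt : Integrable p)
    (hvInt : ∀ j k : Fin n, Integrable (fun x => v x j * v x k))
    (hFourier : ∀ ξ : EuclideanSpace ℝ (Fin n), ξ ≠ 0 →
      𝓕 (fun x => (p x : ℂ)) ξ =
        -∑ j : Fin n, ∑ k : Fin n,
          ((ξ j : ℂ) * (ξ k : ℂ) / (‖ξ‖ ^ 2 : ℝ)) *
            𝓕 (fun x => ((v x j * v x k : ℝ) : ℂ)) ξ) :
    ∀ j k : Fin n,
      ∫ x, v x j * v x k = -(if j = k then (1 : ℝ) else 0) * ∫ x, p x := by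
  exact eq_neg_ite_mul_of_quadratic_form (∫ x, p x) (fun j k => ∫ x, v x j * v x k)
    (fun j k => by simp only [mul_comm])
    (integral_mul_norm_sq_of_fourier_eq p (fun j k x => v x j * v x k) hpInt hvInt hFourier)
end

section
/- Let v : ℝ³ → ℝ³ be measurable with |v|² integrable (v ∈ L²(ℝ³)), and suppose that for every ξ ∈ ℝ³ with ξ ≠ 0 the Fourier transforms satisfy (½|v|²)^(ξ) = −Σ_{j,k=1}^3 (ξ_j ξ_k / |ξ|²) · (v_j v_k)^(ξ). Then v = 0 almost everywhere. -/
open MeasureTheory Real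
open scoped FourierTransform

theorem continuous_fourier_of_integrable_s3 {V : Type*} [NormedAddCommGroup V]
    [InnerProductSpace ℝ V] [FiniteDimensional ℝ V] [MeasurableSpace V] [BorelSpace V]
    {f : V → ℂ} (hf : Integrable f) : Continuous (𝓕 f) :=
  VectorFourier.fourierIntegral_continuous Real.continuous_fourierChar
    (L := innerₗ V) continuous_inner hf

theorem fourier_apply_zero {V : Type*} [NormedAddCommGroup V]
    [InnerProductSpace ℝ V] [FiniteDimensional ℝ V] [MeasurableSpace V] [BorelSpace V]
    (f : V → ℂ) : 𝓕 f 0 = ∫ x, f x := by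
  simp [Real.fourier_eq]

/-- **Liouville theorem, Fourier form.** If `v ∈ L²(ℝ³)` and on the Fourier side
`(½|v|²)^(ξ) = −Σ_{j,k} (ξ_j ξ_k / |ξ|²) (v_j v_k)^(ξ)` for all `ξ ≠ 0`,
then `v = 0` almost everywhere. -/
theorem beltrami_L2_liouville_fourier
    (v : EuclideanSpace ℝ (Fin 3) → EuclideanSpace ℝ (Fin 3))
    (hv : Measurable v)
    (hvL2 : Integrable (fun x => ‖v x‖ ^ 2))
    (hFourier : ∀ ξ : EuclideanSpace ℝ (Fin 3), ξ ≠ 0 →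
      𝓕 (fun x => ((1 / 2 * ‖v x‖ ^ 2 : ℝ) : ℂ)) ξ =
        -∑ j : Fin 3, ∑ k : Fin 3,
          ((ξ j : ℂ) * (ξ k : ℂ) / (‖ξ‖ ^ 2 : ℝ)) *
            𝓕 (fun x => ((v x j * v x k : ℝ) : ℂ)) ξ) :
    v =ᵐ[volume] 0 := by
  have hA : Integrable (fun x => 1 / 2 * ‖v x‖ ^ 2) := hvL2.const_mul _
  have hB : Integrable (fun x => v x 0 * v x 0) := by
    refine hvL2.mono' (by fun_prop) (.of_forall fun x => ?_)
    rw [norm_mul, ← sq]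
    gcongr
    exact PiLp.norm_apply_le (v x) 0
  let e (t : ℝ) : EuclideanSpace ℝ (Fin 3) := EuclideanSpace.single 0 t
  have he : Continuous e := by
    have : e = fun t => t • EuclideanSpace.single 0 1 := by
      ext t i
      simp [e]
    rw [this]
    fun_prop
  have he0 : e 0 = 0 := by ext; simp [e]
  have key : (fun t => 𝓕 (fun x => ((1 / 2 * ‖v x‖ ^ 2 : ℝ) : ℂ)) (e t)) =
      fun t => -𝓕 (fun x => ((v x 0 * v x 0 : ℝ) : ℂ)) (e t) := by
    refine Continuous.ext_on (dense_compl_singleton (0 : ℝ))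
      ((continuous_fourier_of_integrable_s3 hA.ofReal).comp he)
      ((continuous_fourier_of_integrable_s3 hB.ofReal).comp he).neg fun t ht => ?_
    have ht : t ≠ 0 := ht
    have htC : (t : ℂ) ≠ 0 := by exact_mod_cast ht
    have hcoef : (t : ℂ) * t / ((t ^ 2 : ℝ) : ℂ) = 1 := by
      push_cast
      field_simp
    have hne : e t ≠ 0 := by simpa [e] using ht
    have h0 : e t 0 = t := by simp [e]
    have h1 : e t 1 = 0 := by simp [e]
    have h2 : e t 2 = 0 := by simp [e]
    have hnorm : ‖e t‖ ^ 2 = t ^ 2 := by simp [e]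
    simp only [hFourier (e t) hne, Fin.sum_univ_three, h0, h1, h2, hnorm, hcoef]
    simp
  have h0 := congrFun key 0
  simp only [he0, fourier_apply_zero, integral_complex_ofReal] at h0
  have hreal : ∫ x, 1 / 2 * ‖v x‖ ^ 2 = -∫ x, v x 0 * v x 0 := by exact_mod_cast h0
  have hBnonneg : 0 ≤ ∫ x, v x 0 * v x 0 := integral_nonneg fun x => mul_self_nonneg _
  have hAnonneg : 0 ≤ fun x => 1 / 2 * ‖v x‖ ^ 2 := fun x => by positivity
  have hzero : ∫ x, 1 / 2 * ‖v x‖ ^ 2 = 0 :=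
    le_antisymm (by linarith) (integral_nonneg hAnonneg)
  filter_upwards [(integral_eq_zero_iff_of_nonneg hAnonneg hA).1 hzero] with x hx
  simpa using hx
end

section
/- Let v : ℝ³ → ℝ³ be a smooth vector field with div v = 0, and suppose there exists a function λ : ℝ³ → ℝ such that curl v = λ v on ℝ³ (v is a Beltrami flow). If v ∈ L²(ℝ³), i.e. ∫_{ℝ³} |v|² dx < ∞, then v = 0. -/
open MeasureTheory Real

/-- Partial derivative `∂ⱼ f` of a scalar function on `ℝ³`, in the direction of the
`j`-th standard basis vector. -/
noncomputable def pd (j : Fin 3) (f : EuclideanSpace ℝ (Fin 3) → ℝ)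
    (x : EuclideanSpace ℝ (Fin 3)) : ℝ :=
  fderiv ℝ f x (EuclideanSpace.single j 1)

/-- Divergence `div v = ∂₁v₁ + ∂₂v₂ + ∂₃v₃` of a vector field on `ℝ³`. -/
noncomputable def div3 (v : EuclideanSpace ℝ (Fin 3) → EuclideanSpace ℝ (Fin 3))
    (x : EuclideanSpace ℝ (Fin 3)) : ℝ :=
  ∑ i : Fin 3, pd i (fun y => v y i) x

/-- Curl `curl v = (∂₂v₃ − ∂₃v₂, ∂₃v₁ − ∂₁v₃, ∂₁v₂ − ∂₂v₁)` of a vector field on `ℝ³`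
(indices written `0,1,2`). -/
noncomputable def curl3 (v : EuclideanSpace ℝ (Fin 3) → EuclideanSpace ℝ (Fin 3))
    (x : EuclideanSpace ℝ (Fin 3)) : EuclideanSpace ℝ (Fin 3) :=
  EuclideanSpace.single 0 (pd 1 (fun y => v y 2) x - pd 2 (fun y => v y 1) x) +
  EuclideanSpace.single 1 (pd 2 (fun y => v y 0) x - pd 0 (fun y => v y 2) x) +
  EuclideanSpace.single 2 (pd 0 (fun y => v y 1) x - pd 1 (fun y => v y 0) x)

/-- Integration by parts for a partial derivative against a compactly supported function. -/
theorem integral_mul_pd_eq_neg {f g : EuclideanSpace ℝ (Fin 3) → ℝ} (i : Fin 3)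
    (hf : ContDiff ℝ 1 f) (hg : ContDiff ℝ 1 g) (hc : HasCompactSupport f) :
    ∫ x, f x * pd i g x = -∫ x, pd i f x * g x := by
  have hf' : Continuous (fun x => pd i f x) :=
    (hf.continuous_fderiv one_ne_zero).clm_apply continuous_const
  have hg' : Continuous (fun x => pd i g x) :=
    (hg.continuous_fderiv one_ne_zero).clm_apply continuous_const
  have hc' : HasCompactSupport (fun x => pd i f x) := hc.fderiv_apply (𝕜 := ℝ) _
  exact integral_mul_fderiv_eq_neg_fderiv_mul_of_integrable
    ((hf'.mul hg.continuous).integrable_of_hasCompactSupport hc'.mul_right)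
    ((hf.continuous.mul hg').integrable_of_hasCompactSupport hc.mul_right)
    ((hf.continuous.mul hg.continuous).integrable_of_hasCompactSupport hc.mul_right)
    (fun x _ => hf.differentiable one_ne_zero x) (fun x _ => hg.differentiable one_ne_zero x)

theorem fderiv_apply_eq_sum_pd (f : EuclideanSpace ℝ (Fin 3) → ℝ)
    (x w : EuclideanSpace ℝ (Fin 3)) : fderiv ℝ f x w = ∑ i, pd i f x * w i := by
  have hw : w = ∑ i, w i • EuclideanSpace.single i (1 : ℝ) := by
    ext j
    fin_cases j <;> simp [Fin.sum_univ_three]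
  conv_lhs => rw [hw]
  simp [pd, mul_comm]

/-- Divergence theorem against a compactly supported scalar function. -/
theorem integral_mul_div3_eq_neg {f : EuclideanSpace ℝ (Fin 3) → ℝ}
    {w : EuclideanSpace ℝ (Fin 3) → EuclideanSpace ℝ (Fin 3)}
    (hf : ContDiff ℝ 1 f) (hw : ContDiff ℝ 1 w) (hc : HasCompactSupport f) :
    ∫ x, f x * div3 w x = -∫ x, fderiv ℝ f x (w x) := by
  have hwi (i : Fin 3) : ContDiff ℝ 1 (fun x => w x i) := by fun_prop
  have hf' (i : Fin 3) : Continuous (fun x => pd i f x) :=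
    (hf.continuous_fderiv one_ne_zero).clm_apply continuous_const
  have hw' (i : Fin 3) : Continuous (fun x => pd i (fun y => w y i) x) :=
    ((hwi i).continuous_fderiv one_ne_zero).clm_apply continuous_const
  have hc' (i : Fin 3) : HasCompactSupport (fun x => pd i f x) := hc.fderiv_apply (𝕜 := ℝ) _
  simp only [fderiv_apply_eq_sum_pd, div3, Finset.mul_sum]
  rw [integral_finsetSum, integral_finsetSum, ← Finset.sum_neg_distrib]
  · exact Finset.sum_congr rfl fun i _ => integral_mul_pd_eq_neg i hf (hwi i) hc
  · exact fun i _ => ((hf' i).mul (hwi i).continuous).integrable_of_hasCompactSupport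
      (hc' i).mul_right
  · exact fun i _ => (hf.continuous.mul (hw' i)).integrable_of_hasCompactSupport hc.mul_right

/-- The contraction of the position vector with the stress tensor `v ⊗ v - ½ |v|² Id`
of a Beltrami flow. -/
noncomputable def virialField (v : EuclideanSpace ℝ (Fin 3) → EuclideanSpace ℝ (Fin 3))
    (x : EuclideanSpace ℝ (Fin 3)) : EuclideanSpace ℝ (Fin 3) :=
  inner ℝ (v x) x • v x - (‖v x‖ ^ 2 / 2) • x

theorem norm_virialField_le (v : EuclideanSpace ℝ (Fin 3) → EuclideanSpace ℝ (Fin 3))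
    (x : EuclideanSpace ℝ (Fin 3)) : ‖virialField v x‖ ≤ 3 / 2 * ‖v x‖ ^ 2 * ‖x‖ := by
  calc ‖virialField v x‖ ≤ ‖inner ℝ (v x) x • v x‖ + ‖(‖v x‖ ^ 2 / 2) • x‖ := norm_sub_le _ _
    _ = ‖inner ℝ (v x) x‖ * ‖v x‖ + ‖v x‖ ^ 2 / 2 * ‖x‖ := by
      rw [norm_smul, norm_smul, Real.norm_of_nonneg (by positivity : 0 ≤ ‖v x‖ ^ 2 / 2)]
    _ ≤ ‖v x‖ * ‖x‖ * ‖v x‖ + ‖v x‖ ^ 2 / 2 * ‖x‖ := by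
      gcongr
      exact norm_inner_le_norm _ _
    _ = 3 / 2 * ‖v x‖ ^ 2 * ‖x‖ := by ring

theorem contDiff_virialField {n : WithTop ℕ∞}
    {v : EuclideanSpace ℝ (Fin 3) → EuclideanSpace ℝ (Fin 3)}
    (hv : ContDiff ℝ n v) : ContDiff ℝ n (virialField v) :=
  ((hv.inner ℝ contDiff_id).smul hv).sub (((hv.norm_sq ℝ).div_const 2).smul contDiff_id)

theorem pd_virialField {v : EuclideanSpace ℝ (Fin 3) → EuclideanSpace ℝ (Fin 3)}
    {x : EuclideanSpace ℝ (Fin 3)} (hv : DifferentiableAt ℝ v x) (i k : Fin 3) :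
    pd k (fun y => virialField v y i) x =
      (∑ j, (pd k (fun y => v y j) x * x j + v x j * (Pi.single k 1 : Fin 3 → ℝ) j)) * v x i
        + (∑ j, v x j * x j) * pd k (fun y => v y i) x
        - (∑ j, v x j * pd k (fun y => v y j) x) * x i
        - (∑ j, v x j ^ 2) / 2 * (Pi.single k 1 : Fin 3 → ℝ) i := by
  have hvj (j : Fin 3) : HasFDerivAt (fun y => v y j) (fderiv ℝ (fun y => v y j) x) x :=
    ((differentiableAt_euclidean.1 hv) j).hasFDerivAt
  have hxj (j : Fin 3) : HasFDerivAt (fun y : EuclideanSpace ℝ (Fin 3) => y j)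
      (PiLp.proj 2 (fun _ : Fin 3 => ℝ) j : EuclideanSpace ℝ (Fin 3) →L[ℝ] ℝ) x :=
    PiLp.hasFDerivAt_apply (𝕜 := ℝ) 2 x j
  have hW : (fun y => virialField v y i) = fun y =>
      (∑ j, v y j * y j) * v y i - (∑ j, v y j * v y j) * (y i * (1 / 2)) := by
    funext y
    simp only [virialField, EuclideanSpace.norm_sq_eq, PiLp.inner_apply, PiLp.sub_apply,
      PiLp.smul_apply, smul_eq_mul, Fin.sum_univ_three, Real.norm_eq_abs, sq_abs,
      RCLike.inner_apply, conj_trivial]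
    ring
  have h1 := HasFDerivAt.fun_sum (u := Finset.univ) fun j _ => (hvj j).mul (hxj j)
  have h2 := HasFDerivAt.fun_sum (u := Finset.univ) fun j _ => (hvj j).mul (hvj j)
  have h := (h1.mul (hvj i)).sub (h2.mul ((hxj i).mul_const (1 / 2)))
  rw [pd, (h.congr_of_eventuallyEq (.of_eq hW)).fderiv]
  simp [Fin.sum_univ_three, pd, Pi.single_apply, -mul_ite]
  ring

/-- The virial identity: for a Beltrami flow, the stress tensor is divergence free and has
trace `-|v|² / 2`. -/
theorem div3_virialField {v : EuclideanSpace ℝ (Fin 3) → EuclideanSpace ℝ (Fin 3)}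
    {x : EuclideanSpace ℝ (Fin 3)} (hv : DifferentiableAt ℝ v x) (hdiv : div3 v x = 0) {c : ℝ}
    (hbel : curl3 v x = c • v x) : div3 (virialField v) x = -(‖v x‖ ^ 2 / 2) := by
  have h0 := congrArg (fun w : EuclideanSpace ℝ (Fin 3) => w 0) hbel
  have h1 := congrArg (fun w : EuclideanSpace ℝ (Fin 3) => w 1) hbel
  have h2 := congrArg (fun w : EuclideanSpace ℝ (Fin 3) => w 2) hbel
  simp [curl3] at h0 h1 h2
  simp only [div3, Fin.sum_univ_three] at hdiv
  simp only [div3, pd_virialField hv, EuclideanSpace.norm_sq_eq, Fin.sum_univ_three,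
    Real.norm_eq_abs, sq_abs]
  simp
  linear_combination (v x 0 * x 0 + v x 1 * x 1 + v x 2 * x 2) * hdiv
    + (v x 1 * x 2 - v x 2 * x 1) * h0 + (v x 2 * x 0 - v x 0 * x 2) * h1
    + (v x 0 * x 1 - v x 1 * x 0) * h2

open Filter Topology in
/-- A continuously differentiable field `w` of at most linear growth relative to an integrable
weight `g` has integral of divergence zero. -/
theorem integral_eq_zero_of_div3_eq {w : EuclideanSpace ℝ (Fin 3) → EuclideanSpace ℝ (Fin 3)}
    {g : EuclideanSpace ℝ (Fin 3) → ℝ} {C : ℝ} (hC : 0 ≤ C) (hw : ContDiff ℝ 1 w) (hg : Integrable g)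
    (hwg : ∀ x, ‖w x‖ ≤ C * |g x| * ‖x‖) (hdiv : ∀ x, div3 w x = g x) : ∫ x, g x = 0 := by
  let χ : ContDiffBump (0 : EuclideanSpace ℝ (Fin 3)) := ⟨1, 2, one_pos, one_lt_two⟩
  have hχ : ContDiff ℝ 1 χ := χ.contDiff
  have hχ' : Continuous (fderiv ℝ χ) := hχ.continuous_fderiv one_ne_zero
  have hsmul : Tendsto (fun c : ℝ => c) (𝓝[≠] 0) (𝓝 0) := tendsto_id.mono_left nhdsWithin_le_nhds
  have hx (x : EuclideanSpace ℝ (Fin 3)) :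
      Tendsto (fun c : ℝ => c • x) (𝓝[≠] 0) (𝓝 0) := by
    simpa using hsmul.smul_const x
  have hident (c : ℝ) (hc : c ≠ 0) :
      ∫ x, χ (c • x) * g x = -∫ x, c * fderiv ℝ χ (c • x) (w x) := by
    have h := integral_mul_div3_eq_neg (f := fun x => χ (c • x)) (hχ.comp (contDiff_const_smul c))
      hw (χ.hasCompactSupport.comp_homeomorph (Homeomorph.smulOfNeZero c hc))
    simpa [hdiv, fderiv_comp_smul] using h
  have hleft : Tendsto (fun c : ℝ => ∫ x, χ (c • x) * g x) (𝓝[≠] 0) (𝓝 (∫ x, g x)) := by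
    refine tendsto_integral_filter_of_dominated_convergence (fun x => |g x|) ?_ ?_ hg.abs ?_
    · exact .of_forall fun c =>
        (χ.continuous.comp (continuous_const_smul c)).aestronglyMeasurable.mul
          hg.aestronglyMeasurable
    · refine .of_forall fun c => .of_forall fun x => ?_
      rw [norm_mul, Real.norm_of_nonneg χ.nonneg, Real.norm_eq_abs]
      exact mul_le_of_le_one_left (abs_nonneg _) χ.le_one
    · refine .of_forall fun x => ?_
      have h := ((χ.continuous.tendsto 0).comp (hx x)).mul_const (g x)
      have h0 : χ 0 = 1 := χ.one_of_mem_closedBall (by simp [χ])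
      simpa [h0] using h
  have hright : Tendsto (fun c : ℝ => ∫ x, c * fderiv ℝ χ (c • x) (w x)) (𝓝[≠] 0) (𝓝 0) := by
    obtain ⟨M, hM⟩ : ∃ M, ∀ y, ‖‖y‖ * ‖fderiv ℝ χ y‖‖ ≤ M :=
      Continuous.bounded_above_of_compact_support (by fun_prop)
        ((χ.hasCompactSupport.fderiv ℝ).norm.mul_left)
    have hM0 (y) : ‖y‖ * ‖fderiv ℝ χ y‖ ≤ M := (le_abs_self _).trans (hM y)
    rw [← integral_zero (EuclideanSpace ℝ (Fin 3)) ℝ]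
    refine tendsto_integral_filter_of_dominated_convergence (fun x => M * (C * |g x|)) ?_ ?_
      ((hg.abs.const_mul C).const_mul M) ?_
    · refine .of_forall fun c => Continuous.aestronglyMeasurable ?_
      have := hw.continuous
      fun_prop
    · refine .of_forall fun c => .of_forall fun x => ?_
      calc ‖c * fderiv ℝ χ (c • x) (w x)‖ ≤ ‖c‖ * (‖fderiv ℝ χ (c • x)‖ * (C * |g x| * ‖x‖)) := by
            rw [norm_mul]
            gcongr
            exact (ContinuousLinearMap.le_opNorm _ _).trans (by gcongr; exact hwg x)
        _ = ‖c • x‖ * ‖fderiv ℝ χ (c • x)‖ * (C * |g x|) := by rw [norm_smul]; ring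
        _ ≤ M * (C * |g x|) := by gcongr; exact hM0 _
    · refine .of_forall fun x => ?_
      have h := ((hχ'.clm_apply (continuous_const (y := w x))).tendsto 0).comp (hx x)
      simpa using hsmul.mul h
  have heq := hright.neg.congr' (eventually_mem_nhdsWithin.mono fun c hc => (hident c hc).symm)
  simpa using tendsto_nhds_unique hleft heq

/-- **Liouville theorem for finite-energy Beltrami flows.** A smooth divergence-free
Beltrami flow (`curl v = λ v`) with `∫ |v|² dx < ∞` vanishes identically. -/
theorem beltrami_flow_L2_eq_zero
    (v : EuclideanSpace ℝ (Fin 3) → EuclideanSpace ℝ (Fin 3))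
    (hv : ContDiff ℝ (⊤ : ℕ∞) v)
    (hdiv : ∀ x, div3 v x = 0)
    (lam : EuclideanSpace ℝ (Fin 3) → ℝ)
    (hbel : ∀ x, curl3 v x = lam x • v x)
    (hL2 : Integrable (fun x => ‖v x‖ ^ 2)) :
    v = 0 := by
  have hv1 : ContDiff ℝ 1 v := hv.of_le (by exact_mod_cast le_top)
  have hzero_int : ∫ x, -(‖v x‖ ^ 2 / 2) = 0 := by
    refine integral_eq_zero_of_div3_eq (C := 3) (by norm_num) (contDiff_virialField hv1)
      (hL2.div_const 2).neg (fun x => ?_)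
      fun x => div3_virialField (hv1.differentiable one_ne_zero x) (hdiv x) (hbel x)
    refine (norm_virialField_le v x).trans_eq ?_
    rw [abs_neg, abs_of_nonneg (by positivity)]
    ring
  rw [integral_neg, integral_div, neg_eq_zero, div_eq_zero_iff, or_iff_left two_ne_zero] at hzero_int
  have hae := (integral_eq_zero_iff_of_nonneg (fun x => by positivity) hL2).1 hzero_int
  have hzero := (hv1.continuous.norm.pow 2).ae_eq_iff_eq volume continuous_zero |>.1 hae
  funext x
  simpa using congrFun hzero x
end

section
/- Let v : ℝ³ → ℝ³ be a smooth vector field with div v = 0 and curl v = λ v for some function λ : ℝ³ → ℝ. If there exist ε > 0 and constants C, R₀ > 0 such that |v(x)| ≤ C/|x|^{1+ε} for all |x| ≥ R₀, then v = 0. -/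
open MeasureTheory Real

open Set Filter Topology in
/-- A `C¹` field on `ℝⁿ⁺¹` with nonpositive divergence, whose flux through the boundary of large
cubes tends to zero, is divergence free. -/
theorem divergence_eq_zero_of_flux_tendsto_zero {n : ℕ}
    (f : Fin (n + 1) → (Fin (n + 1) → ℝ) → ℝ) (hf : ∀ i, ContDiff ℝ 1 (f i))
    (hsign : ∀ y, ∑ i, fderiv ℝ (f i) y (Pi.single i 1) ≤ 0)
    (B : ℝ → ℝ) (hB : Tendsto (fun R => B R * R ^ n) atTop (𝓝 0))
    (hfB : ∀ᶠ R in atTop, ∀ y i, |y i| = R → |f i y| ≤ B R) (y : Fin (n + 1) → ℝ) :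
    ∑ i, fderiv ℝ (f i) y (Pi.single i 1) = 0 := by
  set h : (Fin (n + 1) → ℝ) → ℝ := fun y => -∑ i, fderiv ℝ (f i) y (Pi.single i 1) with h_def
  have h_nonneg : ∀ y, 0 ≤ h y := fun y => neg_nonneg.2 (hsign y)
  have h_cont : Continuous h := (continuous_finsetSum _ fun i _ =>
    ((hf i).continuous_fderiv one_ne_zero).clm_apply continuous_const).neg
  let Q : ℝ → Set (Fin (n + 1) → ℝ) := fun R => Icc (fun _ => -R) (fun _ => R)
  have h_int : ∀ R, IntegrableOn h (Q R) := fun R => h_cont.continuousOn.integrableOn_Icc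
  have h_bound : ∀ᶠ R in atTop,
      ∫ y in Q R, h y ≤ ∑ _i : Fin (n + 1), 2 * 2 ^ n * (B R * R ^ n) := by
    filter_upwards [hfB, eventually_ge_atTop 0] with R hR hR0
    have key := integral_divergence_of_hasFDerivAt_off_countable' (fun _ => -R) (fun _ => R)
      (fun _ => by linarith) f (fun i y => fderiv ℝ (f i) y) ∅ countable_empty
      (fun i => (hf i).continuous.continuousOn)
      (fun y _ i => ((hf i).differentiable one_ne_zero y).hasFDerivAt)
      (by simpa [h_def, Q] using (h_int R).neg)
    have face : ∀ (i : Fin (n + 1)) (c : ℝ), |c| = R →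
        |∫ z in Icc ((fun _ : Fin (n + 1) => -R) ∘ i.succAbove)
          ((fun _ : Fin (n + 1) => R) ∘ i.succAbove), f i (i.insertNth c z)| ≤
          B R * (2 * R) ^ n := by
      intro i c hc
      have hle : ((fun _ : Fin (n + 1) => -R) ∘ i.succAbove) ≤
          ((fun _ : Fin (n + 1) => R) ∘ i.succAbove) := fun _ => by
        simp only [Function.comp_apply]; linarith
      have hz : ∀ z, ‖f i (i.insertNth (α := fun _ => ℝ) c z)‖ ≤ B R := fun z =>
        hR _ i (by rwa [Fin.insertNth_apply_same])
      refine (norm_setIntegral_le_of_norm_le_const (μ := volume)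
        isCompact_Icc.measure_lt_top fun z _ => hz z).trans_eq ?_
      rw [Measure.real, Real.volume_Icc_pi_toReal hle]
      simp [two_mul]
    simp only [h_def, integral_neg, Q]
    rw [key, ← Finset.sum_neg_distrib]
    refine Finset.sum_le_sum fun i _ => ?_
    have h1 := abs_le.1 (face i R (abs_of_nonneg hR0))
    have h2 := abs_le.1 (face i (-R) (by rw [abs_neg, abs_of_nonneg hR0]))
    have h3 : 2 * 2 ^ n * (B R * R ^ n) = 2 * (B R * (2 * R) ^ n) := by rw [mul_pow]; ring
    linarith [h1.1, h2.2]
  have h_lim : Tendsto (fun R => ∑ _i : Fin (n + 1), 2 * 2 ^ n * (B R * R ^ n)) atTop (𝓝 0) := by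
    have := tendsto_finsetSum Finset.univ
      fun (_ : Fin (n + 1)) _ => hB.const_mul (2 * 2 ^ n)
    rwa [mul_zero, Finset.sum_const_zero] at this
  have h_zero : ∀ R, ∫ y in Q R, h y = 0 := by
    intro R
    refine le_antisymm (ge_of_tendsto h_lim ?_) (integral_nonneg h_nonneg)
    filter_upwards [h_bound, eventually_ge_atTop R] with S hS hRS
    refine (setIntegral_mono_set (h_int S) (ae_of_all _ h_nonneg) ?_).trans hS
    exact (Icc_subset_Icc (fun _ => neg_le_neg hRS) (fun _ => hRS)).eventuallyLE
  have h_ae : h =ᵐ[volume] 0 := by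
    have hcover : (⋃ k : ℕ, Q k) = univ := by
      refine eq_univ_of_forall fun z => mem_iUnion.2 ?_
      obtain ⟨k, hk⟩ := exists_nat_ge ‖z‖
      have hz : ∀ i, |z i| ≤ k := fun i => (norm_le_pi_norm z i).trans hk
      exact ⟨k, fun i => (abs_le.1 (hz i)).1, fun i => (abs_le.1 (hz i)).2⟩
    rw [← Measure.restrict_univ (μ := volume), ← hcover]
    exact (ae_restrict_iUnion_iff _ _).2 fun k =>
      (setIntegral_eq_zero_iff_of_nonneg_ae (ae_of_all _ h_nonneg) (h_int k)).1 (h_zero k)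
  have := congrFun ((h_cont.ae_eq_iff_eq volume continuous_zero).1 h_ae) y
  simpa [h_def] using this

/-- The field `T x / √(1 + |x|²)`, where `T = u ⊗ u - |u|²/2` is the stress tensor of `u`. -/
noncomputable def stressFlux (u : Fin 3 → (Fin 3 → ℝ) → ℝ) (j : Fin 3) (y : Fin 3 → ℝ) : ℝ :=
  ((∑ i, u i y * y i) * u j y - (∑ i, u i y ^ 2) / 2 * y j) * (√(1 + ∑ i, y i ^ 2))⁻¹

theorem contDiff_inv_sqrt_one_add_sum_sq {n : WithTop ℕ∞} :
    ContDiff ℝ n fun y : Fin 3 → ℝ => (√(1 + ∑ i, y i ^ 2))⁻¹ := by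
  have hpos : ∀ y : Fin 3 → ℝ, 0 < 1 + ∑ i, y i ^ 2 := fun y => by positivity
  refine ContDiff.inv (ContDiff.sqrt (by fun_prop) fun y => (hpos y).ne') fun y => ?_
  exact (Real.sqrt_pos.2 (hpos y)).ne'

theorem ContDiff.stressFlux {u : Fin 3 → (Fin 3 → ℝ) → ℝ} {n : WithTop ℕ∞}
    (hu : ∀ i, ContDiff ℝ n (u i)) (j : Fin 3) : ContDiff ℝ n (stressFlux u j) := by
  have := contDiff_inv_sqrt_one_add_sum_sq (n := n)
  unfold _root_.stressFlux
  fun_prop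

theorem fderiv_inv_sqrt_one_add_sum_sq (y : Fin 3 → ℝ) (j : Fin 3) :
    fderiv ℝ (fun y : Fin 3 → ℝ => (√(1 + ∑ i, y i ^ 2))⁻¹) y (Pi.single j 1) =
      -(√(1 + ∑ i, y i ^ 2))⁻¹ ^ 3 * y j := by
  have hpos : 0 < 1 + ∑ i, y i ^ 2 := by positivity
  have hs := Real.sqrt_pos.2 hpos
  have hsum : HasFDerivAt (fun y : Fin 3 → ℝ => 1 + ∑ i, y i ^ 2)
      (∑ i, (2 * y i) • ContinuousLinearMap.proj (R := ℝ) (φ := fun _ : Fin 3 => ℝ) i) y := by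
    refine HasFDerivAt.const_add _ (HasFDerivAt.fun_sum fun i _ => ?_)
    simpa using (hasFDerivAt_apply (𝕜 := ℝ) (F' := fun _ : Fin 3 => ℝ) i y).pow 2
  have h := (hasDerivAt_inv hs.ne').comp_hasFDerivAt y (hsum.sqrt hpos.ne')
  rw [show (fun y : Fin 3 → ℝ => (√(1 + ∑ i, y i ^ 2))⁻¹) =
    Inv.inv ∘ fun y : Fin 3 → ℝ => √(1 + ∑ i, y i ^ 2) from rfl, h.fderiv]
  have : ∑ i, 2 * y i * (Pi.single j (1 : ℝ) : Fin 3 → ℝ) i = 2 * y j := by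
    simp [Pi.single_apply]
  simp only [smul_apply, sum_apply,
    ContinuousLinearMap.proj_apply, smul_eq_mul, this]
  field_simp

theorem fderiv_stressFlux {u : Fin 3 → (Fin 3 → ℝ) → ℝ} {y : Fin 3 → ℝ}
    (hu : ∀ i, DifferentiableAt ℝ (u i) y) (j k : Fin 3) :
    fderiv ℝ (stressFlux u j) y (Pi.single k 1) =
      (((∑ i, fderiv ℝ (u i) y (Pi.single k 1) * y i) + u k y) * u j y +
        (∑ i, u i y * y i) * fderiv ℝ (u j) y (Pi.single k 1) -
        (∑ i, u i y * fderiv ℝ (u i) y (Pi.single k 1)) * y j -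
        (∑ i, u i y ^ 2) / 2 * (Pi.single k (1 : ℝ) : Fin 3 → ℝ) j) * (√(1 + ∑ i, y i ^ 2))⁻¹ -
      ((∑ i, u i y * y i) * u j y - (∑ i, u i y ^ 2) / 2 * y j) *
        ((√(1 + ∑ i, y i ^ 2))⁻¹ ^ 3 * y k) := by
  have hq := (contDiff_inv_sqrt_one_add_sum_sq (n := 1)).differentiable one_ne_zero y
  have hp := fun i => hasFDerivAt_apply (𝕜 := ℝ) (F' := fun _ : Fin 3 => ℝ) i y
  have hd := fun i => (hu i).hasFDerivAt
  have h1 := HasFDerivAt.fun_sum (u := Finset.univ) fun i _ => (hd i).mul (hp i)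
  have h2 := HasFDerivAt.fun_sum (u := Finset.univ) fun i _ => (hd i).mul (hd i)
  have h := ((h1.mul (hd j)).sub ((h2.mul_const (1 / 2)).mul (hp j))).mul hq.hasFDerivAt
  have e : stressFlux u j = fun y => ((∑ i, u i y * y i) * u j y -
      (∑ i, u i y * u i y) * (1 / 2) * y j) * (√(1 + ∑ i, y i ^ 2))⁻¹ := by
    ext z; simp only [stressFlux, ← sq, div_eq_mul_inv, one_mul]
  rw [e]
  refine (congrArg (· (Pi.single k 1)) h.fderiv).trans ?_
  have hk : ∑ i, u i y * (Pi.single k (1 : ℝ) : Fin 3 → ℝ) i = u k y := by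
    simp [Pi.single_apply]
  rw [← hk]
  simp only [add_apply, sub_apply,
    smul_apply, sum_apply,
    ContinuousLinearMap.proj_apply, smul_eq_mul, fderiv_inv_sqrt_one_add_sum_sq,
    Pi.sub_apply, Pi.mul_apply]
  simp only [Fin.sum_univ_three]
  ring

/-- The divergence of the stress flux of a Beltrami flow. -/
theorem divergence_stressFlux {u : Fin 3 → (Fin 3 → ℝ) → ℝ} {y : Fin 3 → ℝ} {l : ℝ}
    (hu : ∀ i, DifferentiableAt ℝ (u i) y)
    (hdiv : ∑ i, fderiv ℝ (u i) y (Pi.single i 1) = 0)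
    (h0 : fderiv ℝ (u 2) y (Pi.single 1 1) - fderiv ℝ (u 1) y (Pi.single 2 1) = l * u 0 y)
    (h1 : fderiv ℝ (u 0) y (Pi.single 2 1) - fderiv ℝ (u 2) y (Pi.single 0 1) = l * u 1 y)
    (h2 : fderiv ℝ (u 1) y (Pi.single 0 1) - fderiv ℝ (u 0) y (Pi.single 1 1) = l * u 2 y) :
    ∑ j, fderiv ℝ (stressFlux u j) y (Pi.single j 1) =
      -((∑ i, u i y ^ 2) / 2 + (∑ i, u i y * y i) ^ 2) * (√(1 + ∑ i, y i ^ 2))⁻¹ ^ 3 := by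
  have hpos : 0 < 1 + ∑ i, y i ^ 2 := by positivity
  have hq : (√(1 + ∑ i, y i ^ 2))⁻¹ ^ 2 * (1 + ∑ i, y i ^ 2) = 1 := by
    rw [inv_pow, Real.sq_sqrt hpos.le, inv_mul_cancel₀ hpos.ne']
  simp only [fderiv_stressFlux hu]
  generalize (√(1 + ∑ i, y i ^ 2))⁻¹ = q at hq ⊢
  simp only [Fin.sum_univ_three, Pi.single_eq_same] at hdiv hq ⊢
  generalize fderiv ℝ (u 0) y = D0 at *
  generalize fderiv ℝ (u 1) y = D1 at *
  generalize fderiv ℝ (u 2) y = D2 at *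
  linear_combination (q * (u 0 y * y 0 + u 1 y * y 1 + u 2 y * y 2)) * hdiv +
    q * (u 1 y * y 2 - u 2 y * y 1) * h0 + q * (u 2 y * y 0 - u 0 y * y 2) * h1 +
    q * (u 0 y * y 1 - u 1 y * y 0) * h2 +
    (u 0 y ^ 2 + u 1 y ^ 2 + u 2 y ^ 2) / 2 * q * hq

theorem abs_stressFlux_le (u : Fin 3 → (Fin 3 → ℝ) → ℝ) (j : Fin 3) (y : Fin 3 → ℝ) :
    |stressFlux u j y| ≤ 3 / 2 * ∑ i, u i y ^ 2 := by
  set N := √(∑ i, u i y ^ 2) with hN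
  set s := √(1 + ∑ i, y i ^ 2) with hs
  have hpos : 0 < 1 + ∑ i, y i ^ 2 := by positivity
  have hs0 : 0 < s := Real.sqrt_pos.2 hpos
  have hN0 : 0 ≤ N := Real.sqrt_nonneg _
  have hN2 : ∑ i, u i y ^ 2 = N ^ 2 := (Real.sq_sqrt (by positivity)).symm
  have hu : |u j y| ≤ N := Real.abs_le_sqrt <|
    Finset.single_le_sum (f := fun i => u i y ^ 2) (fun i _ => sq_nonneg _) (Finset.mem_univ j)
  have hy : |y j| ≤ s := Real.abs_le_sqrt <| (Finset.single_le_sum (f := fun i => y i ^ 2)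
    (fun i _ => sq_nonneg _) (Finset.mem_univ j)).trans (by linarith)
  have hd : |∑ i, u i y * y i| ≤ N * s := by
    rw [hN, hs, ← Real.sqrt_mul (by positivity)]
    refine Real.abs_le_sqrt ((Finset.sum_mul_sq_le_sq_mul_sq _ _ _).trans ?_)
    gcongr
    linarith
  rw [stressFlux, hN2, abs_mul, abs_inv, abs_of_pos hs0, ← div_eq_mul_inv, div_le_iff₀ hs0]
  calc _ ≤ |∑ i, u i y * y i| * |u j y| + N ^ 2 / 2 * |y j| := by
        refine (abs_sub _ _).trans_eq ?_
        rw [abs_mul, abs_mul, abs_of_nonneg (by positivity : 0 ≤ N ^ 2 / 2)]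
    _ ≤ N * s * N + N ^ 2 / 2 * s := by gcongr
    _ = _ := by ring

/-- **Liouville theorem for decaying Beltrami flows.** A smooth divergence-free Beltrami
flow with `|v(x)| ≤ C/|x|^{1+ε}` for `|x| ≥ R₀` (some `ε, C, R₀ > 0`) vanishes
identically. -/
theorem beltrami_flow_decay_eq_zero
    (v : EuclideanSpace ℝ (Fin 3) → EuclideanSpace ℝ (Fin 3))
    (hv : ContDiff ℝ (⊤ : ℕ∞) v)
    (hdiv : ∀ x, div3 v x = 0)
    (lam : EuclideanSpace ℝ (Fin 3) → ℝ)
    (hbel : ∀ x, curl3 v x = lam x • v x)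
    (hdecay : ∃ ε > (0 : ℝ), ∃ C > (0 : ℝ), ∃ R₀ > (0 : ℝ),
      ∀ x : EuclideanSpace ℝ (Fin 3), R₀ ≤ ‖x‖ → ‖v x‖ ≤ C / ‖x‖ ^ (1 + ε)) :
    v = 0 := by
  obtain ⟨ε, hε, C, hC, R₀, hR₀, hdec⟩ := hdecay
  let u : Fin 3 → (Fin 3 → ℝ) → ℝ := fun i y => v (WithLp.toLp 2 y) i
  have hvi : ∀ i, ContDiff ℝ 1 fun x => v x i := fun i =>
    contDiff_euclidean.1 (hv.of_le (mod_cast le_top)) i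
  have hu : ∀ i, ContDiff ℝ 1 (u i) := fun i =>
    (hvi i).comp (EuclideanSpace.equiv (Fin 3) ℝ).symm.contDiff
  have hud : ∀ i y, DifferentiableAt ℝ (u i) y := fun i => (hu i).differentiable one_ne_zero
  have hpd : ∀ i j y, fderiv ℝ (u i) y (Pi.single j 1) =
      pd j (fun x => v x i) (WithLp.toLp 2 y) := by
    intro i j y
    have h := (((hvi i).differentiable one_ne_zero) (WithLp.toLp 2 y)).hasFDerivAt.comp y
      (PiLp.hasFDerivAt_toLp (𝕜 := ℝ) 2 y)
    exact congrArg (· (Pi.single j 1)) h.fderiv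
  have hcurl : ∀ y i, curl3 v (WithLp.toLp 2 y) i = lam (WithLp.toLp 2 y) * u i y := by
    intro y i
    rw [hbel]
    rfl
  have hflux : ∀ y, ∑ j, fderiv ℝ (stressFlux u j) y (Pi.single j 1) =
      -((∑ i, u i y ^ 2) / 2 + (∑ i, u i y * y i) ^ 2) * (√(1 + ∑ i, y i ^ 2))⁻¹ ^ 3 := by
    intro y
    refine divergence_stressFlux (l := lam (WithLp.toLp 2 y)) (fun i => hud i y) ?_ ?_ ?_ ?_
    · simp only [hpd]
      exact hdiv _
    · simpa [curl3, hpd] using hcurl y 0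
    · simpa [curl3, hpd] using hcurl y 1
    · simpa [curl3, hpd] using hcurl y 2
  have hsq : ∀ y, ∑ i, u i y ^ 2 = ‖v (WithLp.toLp 2 y)‖ ^ 2 := fun y =>
    (EuclideanSpace.real_norm_sq_eq _).symm
  have hzero := divergence_eq_zero_of_flux_tendsto_zero (stressFlux u) (ContDiff.stressFlux hu)
    (fun y => by
      rw [hflux, neg_mul]
      exact neg_nonpos.2 (by positivity))
    (fun R => 3 / 2 * (C / R ^ (1 + ε)) ^ 2)
    (by
      have hlim := ((tendsto_rpow_neg_atTop (by positivity : 0 < 2 * ε)).const_mul (3 / 2 * C ^ 2))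
      rw [mul_zero] at hlim
      refine hlim.congr' ?_
      filter_upwards [Filter.eventually_gt_atTop 0] with R hR
      rw [Real.rpow_neg hR.le, Real.rpow_add hR, Real.rpow_one, mul_comm 2 ε,
        Real.rpow_mul hR.le, Real.rpow_two]
      have := Real.rpow_pos_of_pos hR ε
      field_simp)
    (by
      filter_upwards [Filter.eventually_ge_atTop R₀] with R hR y i hy
      have hRy : R ≤ ‖WithLp.toLp 2 y‖ := hy ▸ PiLp.norm_apply_le (WithLp.toLp 2 y) i
      have hR0 : 0 < R := hR₀.trans_le hR
      refine (abs_stressFlux_le u i y).trans ?_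
      rw [hsq]
      gcongr
      refine (hdec _ (hR.trans hRy)).trans ?_
      gcongr)
  funext x
  have hx := hzero x
  rw [hflux, neg_mul, neg_eq_zero, hsq] at hx
  have hpos : 0 < (√(1 + ∑ i, x i ^ 2))⁻¹ ^ 3 := by positivity
  have hx' := (mul_eq_zero.1 hx).resolve_right hpos.ne'
  have hv0 : ‖v x‖ ^ 2 = 0 := by
    have : 0 ≤ (∑ i, u i x * x i) ^ 2 := sq_nonneg _
    have : 0 ≤ ‖v x‖ ^ 2 := sq_nonneg _
    change ‖v x‖ ^ 2 / 2 + _ = 0 at hx'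
    linarith
  simpa using hv0
end

section
/- Let v : ℝ³ → ℝ³ be a smooth vector field with div v = 0 and curl v = λ v for some function λ : ℝ³ → ℝ. Then for every compactly supported twice continuously differentiable function φ : ℝ³ → ℝ one has Σ_{j,k=1}^3 ∫_{ℝ³} v_j v_k ∂_j∂_k φ dx = ½ ∫_{ℝ³} |v|² Δφ dx, where Δφ = Σ_{j=1}^3 ∂_j² φ. -/
open MeasureTheory Real

lemma contDiff_pd {f : EuclideanSpace ℝ (Fin 3) → ℝ} {m n : WithTop ℕ∞} (hf : ContDiff ℝ n f)
    (hmn : m + 1 ≤ n) (j : Fin 3) : ContDiff ℝ m (pd j f) :=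
  (hf.fderiv_right hmn).clm_apply contDiff_const

lemma hasCompactSupport_pd {f : EuclideanSpace ℝ (Fin 3) → ℝ} (hf : HasCompactSupport f)
    (j : Fin 3) : HasCompactSupport (pd j f) :=
  hf.fderiv_apply (𝕜 := ℝ) (EuclideanSpace.single j 1)

lemma integrable_mul_of_hasCompactSupport {f g : EuclideanSpace ℝ (Fin 3) → ℝ}
    (hf : Continuous f) (hg : Continuous g) (hgs : HasCompactSupport g) :
    Integrable (fun x => f x * g x) :=
  (hf.mul hg).integrable_of_hasCompactSupport hgs.mul_left

lemma integral_mul_pd {f g : EuclideanSpace ℝ (Fin 3) → ℝ}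
    (hf : ContDiff ℝ 1 f) (hg : ContDiff ℝ 1 g) (hgs : HasCompactSupport g) (j : Fin 3) :
    ∫ x, f x * pd j g x = -∫ x, pd j f x * g x :=
  integral_mul_fderiv_eq_neg_fderiv_mul_of_integrable
    (integrable_mul_of_hasCompactSupport (contDiff_pd hf (m := 0) (by simp) j).continuous
      hg.continuous hgs)
    (integrable_mul_of_hasCompactSupport hf.continuous
      (contDiff_pd hg (m := 0) (by simp) j).continuous (hasCompactSupport_pd hgs j))
    (integrable_mul_of_hasCompactSupport hf.continuous hg.continuous hgs)
    (fun x _ => hf.differentiable (by simp) x) (fun x _ => hg.differentiable (by simp) x)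

lemma pd_mul {f g : EuclideanSpace ℝ (Fin 3) → ℝ} {x : EuclideanSpace ℝ (Fin 3)}
    (hf : DifferentiableAt ℝ f x) (hg : DifferentiableAt ℝ g x) (j : Fin 3) :
    pd j (fun y => f y * g y) x = f x * pd j g x + g x * pd j f x := by
  simp [pd, fderiv_fun_mul hf hg]

lemma pd_add {f g : EuclideanSpace ℝ (Fin 3) → ℝ} {x : EuclideanSpace ℝ (Fin 3)}
    (hf : DifferentiableAt ℝ f x) (hg : DifferentiableAt ℝ g x) (j : Fin 3) :
    pd j (fun y => f y + g y) x = pd j f x + pd j g x := by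
  simp [pd, fderiv_fun_add hf hg]

/-- Pointwise form of `div (v ⊗ v) = ∇(½|v|²)` for a Beltrami flow, tested against `w`. -/
lemma sum_pd_mul_of_beltrami {v : EuclideanSpace ℝ (Fin 3) → EuclideanSpace ℝ (Fin 3)}
    {x : EuclideanSpace ℝ (Fin 3)} (hv : ∀ i, DifferentiableAt ℝ (fun y => v y i) x)
    (hdiv : div3 v x = 0) {c : ℝ} (hbel : curl3 v x = c • v x) (w : Fin 3 → ℝ) :
    ∑ j : Fin 3, ∑ k : Fin 3, pd j (fun y => v y j * v y k) x * w k =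
      1 / 2 * ∑ j : Fin 3, pd j (fun y => ‖v y‖ ^ 2) x * w j := by
  have hnorm : (fun y => ‖v y‖ ^ 2) =
      fun y => v y 0 * v y 0 + v y 1 * v y 1 + v y 2 * v y 2 := by
    funext y
    rw [EuclideanSpace.real_norm_sq_eq]
    simp only [Fin.sum_univ_three, sq]
  have hsq : ∀ i, DifferentiableAt ℝ (fun y => v y i * v y i) x :=
    fun i => (hv i).fun_mul (hv i)
  have hpd : ∀ j, pd j (fun y => ‖v y‖ ^ 2) x =
      2 * (v x 0 * pd j (fun y => v y 0) x + v x 1 * pd j (fun y => v y 1) x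
        + v x 2 * pd j (fun y => v y 2) x) := by
    intro j
    rw [hnorm, pd_add ((hsq 0).fun_add (hsq 1)) (hsq 2), pd_add (hsq 0) (hsq 1)]
    simp only [pd_mul (hv _) (hv _)]
    ring
  have h0 := congrArg (fun u => u 0) hbel
  have h1 := congrArg (fun u => u 1) hbel
  have h2 := congrArg (fun u => u 2) hbel
  simp [curl3] at h0 h1 h2
  simp only [div3, Fin.sum_univ_three] at hdiv
  simp only [hpd, pd_mul (hv _) (hv _), Fin.sum_univ_three]
  linear_combination (v x 0 * w 0 + v x 1 * w 1 + v x 2 * w 2) * hdiv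
    + (v x 1 * w 2 - v x 2 * w 1) * h0 + (v x 2 * w 0 - v x 0 * w 2) * h1
    + (v x 0 * w 1 - v x 1 * w 0) * h2

/-- **Weak form of `div div (v ⊗ v) = Δ(½|v|²)` for Beltrami flows.** For a smooth
divergence-free Beltrami flow and every compactly supported `C²` test function `φ`,
`Σ_{j,k} ∫ v_j v_k ∂_j ∂_k φ dx = ½ ∫ |v|² Δφ dx`. -/
theorem beltrami_weak_identity
    (v : EuclideanSpace ℝ (Fin 3) → EuclideanSpace ℝ (Fin 3))
    (hv : ContDiff ℝ (⊤ : ℕ∞) v)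
    (hdiv : ∀ x, div3 v x = 0)
    (lam : EuclideanSpace ℝ (Fin 3) → ℝ)
    (hbel : ∀ x, curl3 v x = lam x • v x) :
    ∀ φ : EuclideanSpace ℝ (Fin 3) → ℝ, ContDiff ℝ 2 φ → HasCompactSupport φ →
      ∑ j : Fin 3, ∑ k : Fin 3,
          ∫ x, v x j * v x k * pd j (fun y => pd k φ y) x =
        1 / 2 * ∫ x, ‖v x‖ ^ 2 * ∑ j : Fin 3, pd j (fun y => pd j φ y) x := by
  intro φ hφ hφs
  have hvi : ∀ i, ContDiff ℝ 1 (fun y => v y i) := fun i =>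
    (contDiff_euclidean.1 hv i).of_le (by exact_mod_cast le_top)
  have hvv : ∀ j k, ContDiff ℝ 1 (fun y => v y j * v y k) := fun j k => (hvi j).mul (hvi k)
  have hnorm : ContDiff ℝ 1 (fun y => ‖v y‖ ^ 2) :=
    (hv.of_le (by exact_mod_cast le_top)).norm_sq ℝ
  have hψ : ∀ k, ContDiff ℝ 1 (pd k φ) := contDiff_pd hφ (by norm_num)
  have hψs : ∀ k, HasCompactSupport (pd k φ) := hasCompactSupport_pd hφs
  have hint : ∀ {f : EuclideanSpace ℝ (Fin 3) → ℝ}, ContDiff ℝ 1 f → ∀ j k,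
      Integrable (fun x => pd j f x * pd k φ x) := fun hf j k =>
    integrable_mul_of_hasCompactSupport (contDiff_pd hf (m := 0) (by simp) j).continuous
      (hψ k).continuous (hψs k)
  have hint' : ∀ j, Integrable (fun x => ‖v x‖ ^ 2 * pd j (pd j φ) x) := fun j =>
    integrable_mul_of_hasCompactSupport hnorm.continuous
      (contDiff_pd (hψ j) (m := 0) (by simp) j).continuous (hasCompactSupport_pd (hψs j) j)
  calc ∑ j : Fin 3, ∑ k : Fin 3, ∫ x, v x j * v x k * pd j (pd k φ) x
      = -∫ x, ∑ j : Fin 3, ∑ k : Fin 3, pd j (fun y => v y j * v y k) x * pd k φ x := by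
        rw [integral_finsetSum _ fun j _ => integrable_finsetSum _ fun k _ => hint (hvv j k) j k,
          ← Finset.sum_neg_distrib]
        refine Finset.sum_congr rfl fun j _ => ?_
        rw [integral_finsetSum _ fun k _ => hint (hvv j k) j k, ← Finset.sum_neg_distrib]
        exact Finset.sum_congr rfl fun k _ => integral_mul_pd (hvv j k) (hψ k) (hψs k) j
    _ = -∫ x, 1 / 2 * ∑ j : Fin 3, pd j (fun y => ‖v y‖ ^ 2) x * pd j φ x := by
        congr 2 with x
        exact sum_pd_mul_of_beltrami (fun i => (hvi i).differentiable (by simp) x) (hdiv x)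
          (hbel x) fun k => pd k φ x
    _ = 1 / 2 * ∫ x, ‖v x‖ ^ 2 * ∑ j : Fin 3, pd j (pd j φ) x := by
        simp only [Finset.mul_sum _ _ (‖_‖ ^ 2)]
        rw [integral_const_mul, integral_finsetSum _ fun j _ => hint hnorm j j,
          integral_finsetSum _ fun j _ => hint' j, ← mul_neg, ← Finset.sum_neg_distrib]
        congr 1
        exact Finset.sum_congr rfl fun j _ => (integral_mul_pd hnorm (hψ j) (hψs j) j).symm
end

section
/- Let λ ∈ (1, 2) and let v : ℝ³ → ℝ³ be a continuous vector field such that ∫_{ℝ³} |v(x)|² |x|^{λ−2} dx < ∞ and such that for every compactly supported twice continuously differentiable φ : ℝ³ → ℝ one has Σ_{j,k=1}^3 ∫_{ℝ³} v_j v_k ∂_j∂_k φ dx = ½ ∫_{ℝ³} |v|² Δφ dx. Then (λ − 1) ∫_{ℝ³} |v(x)|² |x|^{λ−2} dx = 2(λ − 2) ∫_{ℝ³} (v(x)·x)² |x|^{λ−4} dx, where v·x denotes the Euclidean inner product. -/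
open MeasureTheory Real
open scoped RealInnerProductSpace

lemma pd_radial {G G₁ : ℝ → ℝ} (hG : ∀ s, 0 ≤ s → HasDerivAt G (G₁ s) s) (k : Fin 3)
    (x : EuclideanSpace ℝ (Fin 3)) :
    pd k (fun y => G (‖y‖ ^ 2)) x = 2 * x k * G₁ (‖x‖ ^ 2) := by
  have h : HasFDerivAt (fun y : EuclideanSpace ℝ (Fin 3) => G (‖y‖ ^ 2)) _ x :=
    (hG _ (by positivity)).comp_hasFDerivAt x (hasStrictFDerivAt_norm_sq x).hasFDerivAt
  rw [pd, h.fderiv]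
  simp [EuclideanSpace.inner_single_right]
  ring

lemma pd_pd_radial {G G₁ G₂ : ℝ → ℝ} (hG : ∀ s, 0 ≤ s → HasDerivAt G (G₁ s) s)
    (hG₁ : ∀ s, 0 ≤ s → HasDerivAt G₁ (G₂ s) s) (j k : Fin 3)
    (x : EuclideanSpace ℝ (Fin 3)) :
    pd j (fun y => pd k (fun z => G (‖z‖ ^ 2)) y) x =
      (if j = k then 2 * G₁ (‖x‖ ^ 2) else 0) + 4 * (x j * x k) * G₂ (‖x‖ ^ 2) := by
  simp only [pd_radial hG]
  have h₁ : HasFDerivAt (fun y : EuclideanSpace ℝ (Fin 3) => G₁ (‖y‖ ^ 2)) _ x :=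
    (hG₁ _ (by positivity)).comp_hasFDerivAt x (hasStrictFDerivAt_norm_sq x).hasFDerivAt
  have h₂ : HasFDerivAt (fun y : EuclideanSpace ℝ (Fin 3) => y k)
      (EuclideanSpace.proj k : EuclideanSpace ℝ (Fin 3) →L[ℝ] ℝ) x :=
    (EuclideanSpace.proj k : EuclideanSpace ℝ (Fin 3) →L[ℝ] ℝ).hasFDerivAt
  have h : HasFDerivAt (fun y : EuclideanSpace ℝ (Fin 3) => 2 * y k * G₁ (‖y‖ ^ 2)) _ x :=
    (h₂.const_mul 2).mul h₁
  rw [pd, h.fderiv]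
  simp [EuclideanSpace.inner_single_right, eq_comm]
  split_ifs <;> ring

lemma ContDiff.continuous_pd_pd {φ : EuclideanSpace ℝ (Fin 3) → ℝ} (hφ : ContDiff ℝ 2 φ)
    (j k : Fin 3) : Continuous (pd j (fun y => pd k φ y)) := by
  have h₁ : ContDiff ℝ 1 (fun y => pd k φ y) :=
    (hφ.fderiv_right (m := 1) (by norm_num)).clm_apply contDiff_const
  exact (h₁.continuous_fderiv (by norm_num)).clm_apply continuous_const

lemma HasCompactSupport.pd {φ : EuclideanSpace ℝ (Fin 3) → ℝ} (hφ : HasCompactSupport φ)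
    (k : Fin 3) : HasCompactSupport (pd k φ) :=
  hφ.fderiv_apply (𝕜 := ℝ) (EuclideanSpace.single k 1)

lemma sum_sum_mul_mul_eq_inner_sq (a x : EuclideanSpace ℝ (Fin 3)) (p q : ℝ) :
    ∑ j : Fin 3, ∑ k : Fin 3, a j * a k * ((if j = k then p else 0) + 4 * (x j * x k) * q) =
      p * ‖a‖ ^ 2 + 4 * (⟪a, x⟫ : ℝ) ^ 2 * q := by
  simp [EuclideanSpace.norm_sq_eq, PiLp.inner_apply, Fin.sum_univ_three]
  ring

/-- The weak identity, tested with a radial function `x ↦ G (|x|²)`. -/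
lemma weak_identity_radial {v : EuclideanSpace ℝ (Fin 3) → EuclideanSpace ℝ (Fin 3)}
    (hv : Continuous v)
    (hweak : ∀ φ : EuclideanSpace ℝ (Fin 3) → ℝ, ContDiff ℝ 2 φ → HasCompactSupport φ →
      ∑ j : Fin 3, ∑ k : Fin 3,
          ∫ x, v x j * v x k * pd j (fun y => pd k φ y) x =
        1 / 2 * ∫ x, ‖v x‖ ^ 2 * ∑ j : Fin 3, pd j (fun y => pd j φ y) x)
    {G G₁ G₂ : ℝ → ℝ} (hG : ∀ s, 0 ≤ s → HasDerivAt G (G₁ s) s)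
    (hG₁ : ∀ s, 0 ≤ s → HasDerivAt G₁ (G₂ s) s)
    (hsmooth : ContDiff ℝ 2 (fun x : EuclideanSpace ℝ (Fin 3) => G (‖x‖ ^ 2)))
    (hsupp : HasCompactSupport (fun x : EuclideanSpace ℝ (Fin 3) => G (‖x‖ ^ 2))) :
    ∫ x, (2 * G₁ (‖x‖ ^ 2) * ‖v x‖ ^ 2 + 4 * (⟪v x, x⟫ : ℝ) ^ 2 * G₂ (‖x‖ ^ 2)) =
      ∫ x, ‖v x‖ ^ 2 * (3 * G₁ (‖x‖ ^ 2) + 2 * ‖x‖ ^ 2 * G₂ (‖x‖ ^ 2)) := by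
  have h := hweak _ hsmooth hsupp
  have hi : ∀ j k : Fin 3, Integrable (fun x => v x j * v x k *
      pd j (fun y => pd k (fun z => G (‖z‖ ^ 2)) y) x) := fun j k => by
    refine Continuous.integrable_of_hasCompactSupport ?_ ((hsupp.pd k).pd j).mul_left
    have := hsmooth.continuous_pd_pd j k
    fun_prop
  have hsum : ∑ j : Fin 3, ∑ k : Fin 3,
      ∫ x, v x j * v x k * pd j (fun y => pd k (fun z => G (‖z‖ ^ 2)) y) x =
      ∫ x, ∑ j : Fin 3, ∑ k : Fin 3,
        v x j * v x k * pd j (fun y => pd k (fun z => G (‖z‖ ^ 2)) y) x := by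
    rw [integral_finsetSum _ fun j _ => integrable_finsetSum _ fun k _ => hi j k]
    exact Finset.sum_congr rfl fun j _ => (integral_finsetSum _ fun k _ => hi j k).symm
  rw [hsum, ← integral_const_mul] at h
  simp only [pd_pd_radial hG hG₁, sum_sum_mul_mul_eq_inner_sq] at h
  rw [h]
  congr 1 with x
  simp [EuclideanSpace.norm_sq_eq, Fin.sum_univ_three]
  ring

/-- A smooth cut-off on the line with its first two derivatives. -/
lemma exists_smooth_cutoff : ∃ σ σ₁ σ₂ : ℝ → ℝ, ∃ M : ℝ, ContDiff ℝ 2 σ ∧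
    (∀ t, HasDerivAt σ (σ₁ t) t) ∧ (∀ t, HasDerivAt σ₁ (σ₂ t) t) ∧
    (∀ t, t < 1 → σ t = 1 ∧ σ₁ t = 0 ∧ σ₂ t = 0) ∧
    (∀ t, 2 < t → σ t = 0 ∧ σ₁ t = 0 ∧ σ₂ t = 0) ∧
    (∀ t, 0 ≤ t → |σ t| ≤ M ∧ |σ₁ t| ≤ M ∧ |σ₂ t| ≤ M) := by
  let σ : ℝ → ℝ := fun t => Real.smoothTransition (2 - t)
  have hσ : ContDiff ℝ 2 σ := Real.smoothTransition.contDiff.comp (by fun_prop)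
  have hσ₁ : ContDiff ℝ 1 (deriv σ) := by
    have h : ContDiff ℝ (1 + 1) σ := by simpa [one_add_one_eq_two] using hσ
    exact (contDiff_succ_iff_deriv.1 h).2.2
  have hσ₂ : Continuous (deriv (deriv σ)) := hσ₁.continuous_deriv le_rfl
  have hloc : ∀ (U : Set ℝ) (c : ℝ), IsOpen U → (∀ t ∈ U, σ t = c) → ∀ t ∈ U,
      σ t = c ∧ deriv σ t = 0 ∧ deriv (deriv σ) t = 0 := by
    intro U c hU hc
    have h₁ : ∀ t ∈ U, deriv σ t = 0 := fun t ht => by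
      have : σ =ᶠ[nhds t] fun _ => c := Filter.eventually_of_mem (hU.mem_nhds ht) hc
      simpa using this.deriv_eq
    intro t ht
    refine ⟨hc t ht, h₁ t ht, ?_⟩
    have : deriv σ =ᶠ[nhds t] fun _ => 0 := Filter.eventually_of_mem (hU.mem_nhds ht) h₁
    simpa using this.deriv_eq
  have hlow := hloc (Set.Iio 1) 1 isOpen_Iio fun t ht =>
    Real.smoothTransition.one_of_one_le (by have := Set.mem_Iio.1 ht; linarith)
  have hhigh := hloc (Set.Ioi 2) 0 isOpen_Ioi fun t ht =>
    Real.smoothTransition.zero_of_nonpos (by have := Set.mem_Ioi.1 ht; linarith)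
  obtain ⟨C₀, h₀⟩ := isCompact_Icc.exists_bound_of_continuousOn
    (s := Set.Icc (0 : ℝ) 2) hσ.continuous.continuousOn
  obtain ⟨C₁, h₁⟩ := isCompact_Icc.exists_bound_of_continuousOn
    (s := Set.Icc (0 : ℝ) 2) hσ₁.continuous.continuousOn
  obtain ⟨C₂, h₂⟩ := isCompact_Icc.exists_bound_of_continuousOn
    (s := Set.Icc (0 : ℝ) 2) hσ₂.continuousOn
  refine ⟨σ, deriv σ, deriv (deriv σ), |C₀| + |C₁| + |C₂|, hσ,
    fun t => (hσ.differentiable (by norm_num) t).hasDerivAt,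
    fun t => (hσ₁.differentiable (by norm_num) t).hasDerivAt, hlow, hhigh, fun t ht => ?_⟩
  have a₀ := abs_nonneg C₀
  have a₁ := abs_nonneg C₁
  have a₂ := abs_nonneg C₂
  rcases le_or_gt t 2 with h | h
  · have e₀ := (h₀ t ⟨ht, h⟩).trans (le_abs_self _)
    have e₁ := (h₁ t ⟨ht, h⟩).trans (le_abs_self _)
    have e₂ := (h₂ t ⟨ht, h⟩).trans (le_abs_self _)
    rw [Real.norm_eq_abs] at e₀ e₁ e₂
    exact ⟨by linarith, by linarith, by linarith⟩
  · obtain ⟨e₀, e₁, e₂⟩ := hhigh t h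
    rw [e₀, e₁, e₂, abs_zero]
    exact ⟨by positivity, by positivity, by positivity⟩

/-- Compactly supported regularizations of `s ↦ s ^ a` on `[0, ∞)`, with derivatives bounded by,
and converging to, those of the power. -/
lemma exists_rpow_regularization {a : ℝ} (ha₀ : 0 < a) (ha₁ : a < 1) :
    ∃ (G G₁ G₂ : ℝ → ℝ → ℝ) (C : ℝ), 0 ≤ C ∧
      (∀ δ, 0 < δ → δ < 1 →
        (∀ s, 0 ≤ s → HasDerivAt (G δ) (G₁ δ s) s) ∧
        (∀ s, 0 ≤ s → HasDerivAt (G₁ δ) (G₂ δ s) s) ∧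
        (∀ s, 0 ≤ s → ContinuousAt (G₂ δ) s) ∧
        ContDiff ℝ 2 (fun x : EuclideanSpace ℝ (Fin 3) => G δ (‖x‖ ^ 2)) ∧
        HasCompactSupport (fun x : EuclideanSpace ℝ (Fin 3) => G δ (‖x‖ ^ 2)) ∧
        (∀ s, 0 < s → |G₁ δ s| ≤ C * s ^ (a - 1) ∧ |G₂ δ s| ≤ C * s ^ (a - 2))) ∧
      (∀ s, 0 < s →
        Filter.Tendsto (fun δ => G₁ δ s) (nhdsWithin 0 (Set.Ioi 0)) (nhds (a * s ^ (a - 1))) ∧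
        Filter.Tendsto (fun δ => G₂ δ s) (nhdsWithin 0 (Set.Ioi 0))
          (nhds (a * (a - 1) * s ^ (a - 2)))) := by
  obtain ⟨σ, σ₁, σ₂, M, hσ, hσ₁, hσ₂, hlow, hhigh, hM⟩ := exists_smooth_cutoff
  have hM₀ : 0 ≤ M := (abs_nonneg _).trans (hM 0 le_rfl).1
  have hσ₂c : Continuous σ₂ := by
    have e₁ : deriv σ = σ₁ := funext fun t => (hσ₁ t).deriv
    have e₂ : deriv σ₁ = σ₂ := funext fun t => (hσ₂ t).deriv
    have h : ContDiff ℝ (1 + 1) σ := by simpa [one_add_one_eq_two] using hσ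
    have h' : ContDiff ℝ 1 σ₁ := e₁ ▸ (contDiff_succ_iff_deriv.1 h).2.2
    exact e₂ ▸ h'.continuous_deriv le_rfl
  have hpow : ∀ (δ s b : ℝ), 0 < s + δ →
      HasDerivAt (fun s => (s + δ) ^ b) (b * (s + δ) ^ (b - 1)) s := fun δ s b h => by
    simpa using ((hasDerivAt_id s).add_const δ).rpow_const (p := b) (Or.inl h.ne')
  have hlin : ∀ δ s : ℝ, HasDerivAt (fun s => δ * s) δ s := fun δ s => by
    simpa using (hasDerivAt_id s).const_mul δ
  refine ⟨fun δ s => (s + δ) ^ a * σ (δ * s),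
    fun δ s => a * (s + δ) ^ (a - 1) * σ (δ * s) + (s + δ) ^ a * (σ₁ (δ * s) * δ),
    fun δ s => a * ((a - 1) * (s + δ) ^ (a - 2)) * σ (δ * s)
      + 2 * (a * (s + δ) ^ (a - 1) * (σ₁ (δ * s) * δ))
      + (s + δ) ^ a * (σ₂ (δ * s) * δ * δ), 16 * M, by positivity, ?_, ?_⟩
  · intro δ hδ hδ'
    refine ⟨fun s hs => ?_, fun s hs => ?_, fun s hs => ?_, ?_, ?_, fun s hs => ?_⟩
    · exact (hpow δ s a (by positivity)).mul ((hσ₁ _).comp s (hlin δ s))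
    · have h := (((hpow δ s (a - 1) (by positivity)).const_mul a).mul
        ((hσ₁ _).comp s (hlin δ s))).add
        ((hpow δ s a (by positivity)).mul (((hσ₂ _).comp s (hlin δ s)).mul_const δ))
      rw [show a - 1 - 1 = a - 2 by ring] at h
      refine h.congr_deriv ?_
      simp only [Function.comp_apply]
      ring
    · have c : ∀ b : ℝ, ContinuousAt (fun s => (s + δ) ^ b) s := fun b =>
        (hpow δ s b (by positivity)).continuousAt
      have d : ContinuousAt (fun s => δ * s) s := (hlin δ s).continuousAt
      have c₀ : ContinuousAt (fun s => σ (δ * s)) s :=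
        ((hσ₁ _).comp s (hlin δ s)).continuousAt
      have c₁ : ContinuousAt (fun s => σ₁ (δ * s)) s :=
        ((hσ₂ _).comp s (hlin δ s)).continuousAt
      have c₂ : ContinuousAt (fun s => σ₂ (δ * s)) s := by fun_prop
      exact (((continuousAt_const.mul (continuousAt_const.mul (c (a - 2)))).mul c₀).add
        (continuousAt_const.mul ((continuousAt_const.mul (c (a - 1))).mul
          (c₁.mul continuousAt_const)))).add
        ((c a).mul ((c₂.mul continuousAt_const).mul continuousAt_const))
    · have hn : ContDiff ℝ 2 (fun x : EuclideanSpace ℝ (Fin 3) => ‖x‖ ^ 2) := contDiff_norm_sq ℝ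
      exact ((hn.add contDiff_const).rpow_const_of_ne fun x => by positivity).mul
        (hσ.comp (contDiff_const.mul hn))
    · refine HasCompactSupport.intro (isCompact_closedBall 0 (2 / δ + 1)) fun x hx => ?_
      have h₁ : 2 / δ + 1 < ‖x‖ := by simpa using hx
      have h₂ : 0 < 2 / δ := by positivity
      have h₃ : 2 / δ < ‖x‖ ^ 2 := by nlinarith
      have h₄ : 2 < δ * ‖x‖ ^ 2 := by rwa [div_lt_iff₀' hδ] at h₃
      simp [(hhigh _ h₄).1]
    · have hu : 0 < s + δ := by positivity
      have e₀ : (s + δ) ^ a = (s + δ) ^ (a - 2) * (s + δ) * (s + δ) := by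
        rw [← Real.rpow_add_one hu.ne', ← Real.rpow_add_one hu.ne']
        ring_nf
      have e₁ : (s + δ) ^ (a - 1) = (s + δ) ^ (a - 2) * (s + δ) := by
        rw [← Real.rpow_add_one hu.ne']
        ring_nf
      have hb : ∀ b : ℝ, b ≤ 0 → (s + δ) ^ b ≤ s ^ b := fun b hb =>
        Real.rpow_le_rpow_of_nonpos hs (by linarith) hb
      have hw : ∀ τ ∈ ({σ₁ (δ * s), σ₂ (δ * s)} : Set ℝ),
          |(s + δ) * δ * τ| ≤ 3 * M ∧ |(s + δ) * δ * ((s + δ) * δ) * τ| ≤ 9 * M := by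
        intro τ hτ
        have ht : 0 ≤ δ * s := by positivity
        obtain ⟨-, m₁, m₂⟩ := hM _ ht
        rcases le_or_gt (δ * s) 2 with h | h
        · have w₀ : 0 ≤ (s + δ) * δ := by positivity
          have w₁ : (s + δ) * δ ≤ 3 := by nlinarith
          have hτM : |τ| ≤ M := by rcases hτ with rfl | rfl <;> assumption
          rw [abs_mul _ τ, abs_mul _ τ, abs_of_nonneg w₀, abs_of_nonneg (mul_nonneg w₀ w₀)]
          exact ⟨by gcongr, by
            rw [show (9 : ℝ) = 3 * 3 by norm_num]
            gcongr⟩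
        · obtain ⟨-, z₁, z₂⟩ := hhigh _ h
          have : τ = 0 := by rcases hτ with rfl | rfl <;> assumption
          simp [this, hM₀]
      obtain ⟨m₀, -, -⟩ := hM (δ * s) (by positivity)
      obtain ⟨w₁, -⟩ := hw (σ₁ (δ * s)) (by simp)
      obtain ⟨-, w₂⟩ := hw (σ₂ (δ * s)) (by simp)
      have n₀ : |a * σ (δ * s)| ≤ M := by
        rw [abs_mul, abs_of_pos ha₀]
        nlinarith [abs_nonneg (σ (δ * s))]
      have n₁ : |(a - 1) * (a * σ (δ * s))| ≤ M := by
        rw [abs_mul, abs_of_neg (by linarith : a - 1 < 0)]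
        nlinarith [abs_nonneg (a * σ (δ * s))]
      have n₂ : |2 * a * ((s + δ) * δ * σ₁ (δ * s))| ≤ 6 * M := by
        rw [abs_mul, abs_of_pos (by positivity)]
        nlinarith [abs_nonneg ((s + δ) * δ * σ₁ (δ * s))]
      beta_reduce
      constructor
      · have e : a * (s + δ) ^ (a - 1) * σ (δ * s) + (s + δ) ^ a * (σ₁ (δ * s) * δ) =
            (a * σ (δ * s) + (s + δ) * δ * σ₁ (δ * s)) * (s + δ) ^ (a - 1) := by
          rw [e₀, e₁]
          ring
        rw [e, abs_mul, abs_of_pos (Real.rpow_pos_of_pos hu _)]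
        refine mul_le_mul ?_ ?_ (by positivity) (by positivity)
        · exact (abs_add_le _ _).trans (by linarith)
        · exact hb _ (by linarith)
      · have e : a * ((a - 1) * (s + δ) ^ (a - 2)) * σ (δ * s)
            + 2 * (a * (s + δ) ^ (a - 1) * (σ₁ (δ * s) * δ))
            + (s + δ) ^ a * (σ₂ (δ * s) * δ * δ) =
            ((a - 1) * (a * σ (δ * s)) + 2 * a * ((s + δ) * δ * σ₁ (δ * s))
              + (s + δ) * δ * ((s + δ) * δ) * σ₂ (δ * s)) * (s + δ) ^ (a - 2) := by
          rw [e₀, e₁]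
          ring
        rw [e, abs_mul, abs_of_pos (Real.rpow_pos_of_pos hu _)]
        refine mul_le_mul ?_ ?_ (by positivity) (by positivity)
        · exact (abs_add_three _ _ _).trans (by linarith)
        · exact hb _ (by linarith)
  · intro s hs
    have hev : ∀ᶠ δ in nhdsWithin (0 : ℝ) (Set.Ioi 0), δ * s < 1 := by
      refine Filter.Eventually.filter_mono nhdsWithin_le_nhds ?_
      have : Filter.Tendsto (fun δ : ℝ => δ * s) (nhds 0) (nhds 0) :=
        Continuous.tendsto' (by fun_prop) _ _ (by simp)
      exact this.eventually_lt_const one_pos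
    have hlim : ∀ b : ℝ, Filter.Tendsto (fun δ => (s + δ) ^ b) (nhdsWithin 0 (Set.Ioi 0))
        (nhds (s ^ b)) := fun b => by
      have : Filter.Tendsto (fun δ : ℝ => s + δ) (nhdsWithin 0 (Set.Ioi 0)) (nhds s) :=
        (Continuous.tendsto' (by fun_prop) _ _ (by simp)).mono_left nhdsWithin_le_nhds
      exact this.rpow_const (Or.inl hs.ne')
    constructor
    · refine ((hlim (a - 1)).const_mul a).congr' ?_
      filter_upwards [hev] with δ hδ
      obtain ⟨z₀, z₁, -⟩ := hlow _ hδ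
      simp [z₀, z₁]
    · refine ((hlim (a - 2)).const_mul (a * (a - 1))).congr' ?_
      filter_upwards [hev] with δ hδ
      obtain ⟨z₀, z₁, z₂⟩ := hlow _ hδ
      simp [z₀, z₁, z₂]
      ring

/-- **Weighted identity.** If `v` is continuous with `∫ |v|² |x|^{λ−2} dx < ∞`,
`λ ∈ (1,2)`, and `v` satisfies the weak identity
`Σ_{j,k} ∫ v_j v_k ∂_j∂_k φ = ½ ∫ |v|² Δφ` for all compactly supported `C²` functions
`φ`, then `(λ−1) ∫ |v|²|x|^{λ−2} dx = 2(λ−2) ∫ (v·x)²|x|^{λ−4} dx`. -/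
theorem weighted_identity_of_weak_identity
    (l : ℝ) (hl1 : 1 < l) (hl2 : l < 2)
    (v : EuclideanSpace ℝ (Fin 3) → EuclideanSpace ℝ (Fin 3))
    (hv : Continuous v)
    (hint : Integrable (fun x => ‖v x‖ ^ 2 * ‖x‖ ^ (l - 2)))
    (hweak : ∀ φ : EuclideanSpace ℝ (Fin 3) → ℝ, ContDiff ℝ 2 φ → HasCompactSupport φ →
      ∑ j : Fin 3, ∑ k : Fin 3,
          ∫ x, v x j * v x k * pd j (fun y => pd k φ y) x =
        1 / 2 * ∫ x, ‖v x‖ ^ 2 * ∑ j : Fin 3, pd j (fun y => pd j φ y) x) :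
    (l - 1) * ∫ x, ‖v x‖ ^ 2 * ‖x‖ ^ (l - 2) =
      2 * (l - 2) * ∫ x, (⟪v x, x⟫ : ℝ) ^ 2 * ‖x‖ ^ (l - 4) := by
  obtain ⟨G, G₁, G₂, C, hC, hG, hlim⟩ :=
    exists_rpow_regularization (a := l / 2) (by linarith) (by linarith)
  have hpow : ∀ (x : EuclideanSpace ℝ (Fin 3)) (b : ℝ), (‖x‖ ^ 2) ^ b = ‖x‖ ^ (2 * b) :=
    fun x b => by
      rw [Real.rpow_mul (norm_nonneg x)]
      simp
  have hpow₁ : ∀ x : EuclideanSpace ℝ (Fin 3), (‖x‖ ^ 2) ^ (l / 2 - 1) = ‖x‖ ^ (l - 2) :=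
    fun x => by rw [hpow]; ring_nf
  have hpow₂ : ∀ x : EuclideanSpace ℝ (Fin 3), (‖x‖ ^ 2) ^ (l / 2 - 2) = ‖x‖ ^ (l - 4) :=
    fun x => by rw [hpow]; ring_nf
  have hmul : ∀ x : EuclideanSpace ℝ (Fin 3), x ≠ 0 →
      ‖x‖ ^ (l - 2) = ‖x‖ ^ 2 * ‖x‖ ^ (l - 4) := fun x hx => by
    rw [← Real.rpow_natCast, ← Real.rpow_add (norm_pos_iff.2 hx)]
    norm_num
    ring_nf
  have hinner : ∀ x, (⟪v x, x⟫ : ℝ) ^ 2 ≤ ‖v x‖ ^ 2 * ‖x‖ ^ 2 := fun x => by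
    rw [← mul_pow, ← sq_abs]
    exact pow_le_pow_left₀ (abs_nonneg _) (abs_real_inner_le_norm _ _) 2
  have hne : ∀ᵐ x : EuclideanSpace ℝ (Fin 3), x ≠ 0 := Measure.ae_ne volume 0
  have hint' : Integrable (fun x => (⟪v x, x⟫ : ℝ) ^ 2 * ‖x‖ ^ (l - 4)) := by
    refine hint.mono' ?_ ?_
    · have : Measurable v := hv.measurable
      exact Measurable.aestronglyMeasurable (by fun_prop)
    · filter_upwards [hne] with x hx
      rw [Real.norm_of_nonneg (by positivity), hmul x hx, ← mul_assoc]
      gcongr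
      exact hinner x
  have hsmall : ∀ᶠ δ in nhdsWithin (0 : ℝ) (Set.Ioi 0), 0 < δ ∧ δ < 1 :=
    Ioo_mem_nhdsGT one_pos
  have hbound : ∀ δ, 0 < δ → δ < 1 → ∀ x : EuclideanSpace ℝ (Fin 3), x ≠ 0 →
      |G₁ δ (‖x‖ ^ 2)| ≤ C * ‖x‖ ^ (l - 2) ∧ |G₂ δ (‖x‖ ^ 2)| ≤ C * ‖x‖ ^ (l - 4) := by
    intro δ hδ hδ' x hx
    have hs : 0 < ‖x‖ ^ 2 := by have := norm_pos_iff.2 hx; positivity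
    simpa only [hpow₁, hpow₂] using (hG δ hδ hδ').2.2.2.2.2 _ hs
  have hcont : ∀ δ, 0 < δ → δ < 1 →
      Continuous (fun x : EuclideanSpace ℝ (Fin 3) => G₁ δ (‖x‖ ^ 2)) ∧
      Continuous (fun x : EuclideanSpace ℝ (Fin 3) => G₂ δ (‖x‖ ^ 2)) := by
    intro δ hδ hδ'
    obtain ⟨-, h₁, h₂, -⟩ := hG δ hδ hδ'
    have hn : Continuous fun x : EuclideanSpace ℝ (Fin 3) => ‖x‖ ^ 2 := by fun_prop
    exact ⟨continuous_iff_continuousAt.2 fun x =>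
        (h₁ _ (by positivity)).continuousAt.comp (f := fun x : EuclideanSpace ℝ (Fin 3) => ‖x‖ ^ 2)
          hn.continuousAt,
      continuous_iff_continuousAt.2 fun x =>
        (h₂ _ (by positivity)).comp (f := fun x : EuclideanSpace ℝ (Fin 3) => ‖x‖ ^ 2)
          hn.continuousAt⟩
  have hL : Filter.Tendsto
      (fun δ => ∫ x, (2 * G₁ δ (‖x‖ ^ 2) * ‖v x‖ ^ 2 + 4 * (⟪v x, x⟫ : ℝ) ^ 2 * G₂ δ (‖x‖ ^ 2)))
      (nhdsWithin 0 (Set.Ioi 0))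
      (nhds (∫ x, (l * (‖v x‖ ^ 2 * ‖x‖ ^ (l - 2))
        + l * (l - 2) * ((⟪v x, x⟫ : ℝ) ^ 2 * ‖x‖ ^ (l - 4))))) := by
    refine tendsto_integral_filter_of_dominated_convergence
      (fun x => 6 * C * (‖v x‖ ^ 2 * ‖x‖ ^ (l - 2))) ?_ ?_ (hint.const_mul _) ?_
    · filter_upwards [hsmall] with δ hδ
      obtain ⟨c₁, c₂⟩ := hcont δ hδ.1 hδ.2
      have hi : Continuous fun x => 4 * (⟪v x, x⟫ : ℝ) ^ 2 := by fun_prop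
      exact (((continuous_const.mul c₁).mul (hv.norm.pow 2)).add
        (hi.mul c₂)).aestronglyMeasurable
    · filter_upwards [hsmall] with δ hδ
      filter_upwards [hne] with x hx
      obtain ⟨b₁, b₂⟩ := hbound δ hδ.1 hδ.2 x hx
      calc ‖2 * G₁ δ (‖x‖ ^ 2) * ‖v x‖ ^ 2 + 4 * (⟪v x, x⟫ : ℝ) ^ 2 * G₂ δ (‖x‖ ^ 2)‖
          ≤ 2 * |G₁ δ (‖x‖ ^ 2)| * ‖v x‖ ^ 2 + 4 * (⟪v x, x⟫ : ℝ) ^ 2 * |G₂ δ (‖x‖ ^ 2)| := by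
            refine (norm_add_le _ _).trans (le_of_eq ?_)
            simp
        _ ≤ 2 * (C * ‖x‖ ^ (l - 2)) * ‖v x‖ ^ 2
            + 4 * (‖v x‖ ^ 2 * ‖x‖ ^ 2) * (C * ‖x‖ ^ (l - 4)) := by
            gcongr
            exact hinner x
        _ = 6 * C * (‖v x‖ ^ 2 * ‖x‖ ^ (l - 2)) := by
            rw [hmul x hx]
            ring
    · filter_upwards [hne] with x hx
      have hs : 0 < ‖x‖ ^ 2 := by have := norm_pos_iff.2 hx; positivity
      obtain ⟨t₁, t₂⟩ := hlim _ hs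
      rw [hpow₁] at t₁
      rw [hpow₂] at t₂
      convert ((t₁.const_mul 2).mul_const (‖v x‖ ^ 2)).add
        (t₂.const_mul (4 * (⟪v x, x⟫ : ℝ) ^ 2)) using 2
      ring
  have hR : Filter.Tendsto
      (fun δ => ∫ x, ‖v x‖ ^ 2 * (3 * G₁ δ (‖x‖ ^ 2) + 2 * ‖x‖ ^ 2 * G₂ δ (‖x‖ ^ 2)))
      (nhdsWithin 0 (Set.Ioi 0))
      (nhds (∫ x, l / 2 * (l + 1) * (‖v x‖ ^ 2 * ‖x‖ ^ (l - 2)))) := by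
    refine tendsto_integral_filter_of_dominated_convergence
      (fun x => 5 * C * (‖v x‖ ^ 2 * ‖x‖ ^ (l - 2))) ?_ ?_ (hint.const_mul _) ?_
    · filter_upwards [hsmall] with δ hδ
      obtain ⟨c₁, c₂⟩ := hcont δ hδ.1 hδ.2
      exact ((hv.norm.pow 2).mul ((continuous_const.mul c₁).add
        ((continuous_const.mul (continuous_norm.pow 2)).mul c₂))).aestronglyMeasurable
    · filter_upwards [hsmall] with δ hδ
      filter_upwards [hne] with x hx
      obtain ⟨b₁, b₂⟩ := hbound δ hδ.1 hδ.2 x hx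
      calc ‖‖v x‖ ^ 2 * (3 * G₁ δ (‖x‖ ^ 2) + 2 * ‖x‖ ^ 2 * G₂ δ (‖x‖ ^ 2))‖
          ≤ ‖v x‖ ^ 2 * (3 * |G₁ δ (‖x‖ ^ 2)| + 2 * ‖x‖ ^ 2 * |G₂ δ (‖x‖ ^ 2)|) := by
            rw [norm_mul, norm_pow, norm_norm]
            gcongr
            refine (norm_add_le _ _).trans (le_of_eq ?_)
            simp
        _ ≤ ‖v x‖ ^ 2 * (3 * (C * ‖x‖ ^ (l - 2)) + 2 * ‖x‖ ^ 2 * (C * ‖x‖ ^ (l - 4))) := by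
            gcongr
        _ = 5 * C * (‖v x‖ ^ 2 * ‖x‖ ^ (l - 2)) := by
            rw [hmul x hx]
            ring
    · filter_upwards [hne] with x hx
      have hs : 0 < ‖x‖ ^ 2 := by have := norm_pos_iff.2 hx; positivity
      obtain ⟨t₁, t₂⟩ := hlim _ hs
      rw [hpow₁] at t₁
      rw [hpow₂] at t₂
      convert ((t₁.const_mul 3).add (t₂.const_mul (2 * ‖x‖ ^ 2))).const_mul (‖v x‖ ^ 2) using 2
      rw [hmul x hx]
      ring
  have heq := tendsto_nhds_unique_of_eventuallyEq hL hR (by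
    filter_upwards [hsmall] with δ hδ
    obtain ⟨h₀, h₁, -, h₃, h₄, -⟩ := hG δ hδ.1 hδ.2
    exact weak_identity_radial hv hweak h₀ h₁ h₃ h₄)
  rw [integral_add (hint.const_mul _) (hint'.const_mul _), integral_const_mul,
    integral_const_mul, integral_const_mul] at heq
  have hl : l ≠ 0 := by linarith
  refine mul_left_cancel₀ hl ?_
  linear_combination -2 * heq
end
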